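/- Let n ≥ 3, γ > 0 and let α, β be real numbers with −π ≤ (α+β)/2 < π and 0 < β−α < π, and let A be an invertible n×n complex matrix. If det(I + A·B) ≠ 0 for every matrix B ∈ S_γ(α,β), then there exist nonnegative real numbers k₁, k₂, k₃, k₄ such that the Hermitian matrix k₁·(I − γ²·A*A) + k₂·H(e^{−i(π/2−β)}·A) + k₃·H(e^{i(π/2+α)}·A) + k₄·(γ·sec((β−α)/2)·H(e^{i(α+β)/2}·A) + I) is positive definite. -/

import Mathlib

open Matrix
open scoped ComplexOrder

noncomputable section

/-- Hermitian part of a complex matrix: `H(A) = (A + A*) / 2`. -/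
def Hpart {n : ℕ} (A : Matrix (Fin n) (Fin n) ℂ) : Matrix (Fin n) (Fin n) ℂ :=
  (2⁻¹ : ℂ) • (A + Aᴴ)

/-- Membership in the sectored-disk set `S_γ(α,β)`. -/
def memSDab {n : ℕ} (γ α β : ℝ) (B : Matrix (Fin n) (Fin n) ℂ) : Prop :=
  (((γ ^ 2 : ℝ) : ℂ) • (1 : Matrix (Fin n) (Fin n) ℂ) - Bᴴ * B).PosSemidef ∧
  (Hpart (Complex.exp (Complex.I * ((Real.pi / 2 - β : ℝ) : ℂ)) • B)).PosSemidef ∧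
  (Hpart (Complex.exp (-Complex.I * ((Real.pi / 2 + α : ℝ) : ℂ)) • B)).PosSemidef

open scoped ComplexConjugate

/-- Intermediate value theorem along a path on which `G` passes from `≥ 0` to `≤ 0`. -/
theorem exists_zero_on_path {X : Type*} [TopologicalSpace X] {G : X → ℝ} (hG : Continuous G)
    {f : ℝ → X} {u v : ℝ} (huv : u ≤ v) (hf : ContinuousOn f (Set.Icc u v))
    (h0 : 0 ≤ G (f u)) (h1 : G (f v) ≤ 0) : ∃ t ∈ Set.Icc u v, G (f t) = 0 := by
  have := intermediate_value_Icc' huv (hG.comp_continuousOn hf)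
  obtain ⟨t, ht, h⟩ := this ⟨h1, h0⟩
  exact ⟨t, ht, h⟩

/-- A unit complex number at which an odd trigonometric expression is real. -/
theorem exists_unit_im_eq_zero (p q : ℂ) :
    ∃ z : ℂ, z * conj z = 1 ∧ (z * (p * z ^ 2 + q)).im = 0 := by
  have hc : Continuous fun t : ℝ => (Complex.exp (t * Complex.I) *
      (p * Complex.exp (t * Complex.I) ^ 2 + q)).im := by fun_prop
  have hunit : ∀ t : ℝ, Complex.exp (t * Complex.I) * conj (Complex.exp (t * Complex.I)) = 1 := by
    intro t
    rw [Complex.mul_conj, Complex.normSq_eq_norm_sq, Complex.norm_exp_ofReal_mul_I]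
    simp
  have hpi : (Complex.exp ((Real.pi : ℝ) * Complex.I) *
      (p * Complex.exp ((Real.pi : ℝ) * Complex.I) ^ 2 + q)).im =
      -(Complex.exp ((0 : ℝ) * Complex.I) *
        (p * Complex.exp ((0 : ℝ) * Complex.I) ^ 2 + q)).im := by
    rw [Complex.exp_pi_mul_I]; simp
  rcases le_total 0 (Complex.exp ((0 : ℝ) * Complex.I) *
      (p * Complex.exp ((0 : ℝ) * Complex.I) ^ 2 + q)).im with h | h
  · obtain ⟨t, -, ht⟩ := intermediate_value_Icc' Real.pi_pos.le hc.continuousOn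
      (show (0 : ℝ) ∈ _ from ⟨by rw [hpi]; linarith, h⟩)
    exact ⟨_, hunit t, ht⟩
  · obtain ⟨t, -, ht⟩ := intermediate_value_Icc Real.pi_pos.le hc.continuousOn
      (show (0 : ℝ) ∈ _ from ⟨h, by rw [hpi]; linarith⟩)
    exact ⟨_, hunit t, ht⟩

theorem exists_common_zero_of_vanishing (m l : ℂ) (G : ℂ × ℂ × ℂ → ℝ) (hG : Continuous G)
    (h1 : ∀ a : ℂ, a ≠ 0 → 0 < G (a, 0, 0)) (h2 : ∀ b : ℂ, b ≠ 0 → G (0, b, 0) < 0) :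
    ∃ a b c : ℂ, (a, b, c) ≠ 0 ∧
      conj a * b + m * (conj c * a) + l * (c * conj c) = 0 ∧ G (a, b, c) = 0 := by
  by_cases hl : l = 0
  · subst hl
    rcases le_total (G (0, -m, 1)) 0 with h | h
    · obtain ⟨t, ht, h⟩ := exists_zero_on_path hG (u := 0) (v := 1)
        (f := fun r : ℝ => ((1 - r : ℂ), (-r * m : ℂ), (r : ℂ))) zero_le_one
        (by fun_prop) (by simpa using (h1 1 one_ne_zero).le) (by simpa using h)
      refine ⟨_, _, _, ?_, ?_, h⟩
      · intro h
        simp only [Prod.mk_eq_zero] at h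
        obtain ⟨ha, -, hc⟩ := h
        simp [hc] at ha
      · simp; ring
    · obtain ⟨t, ht, h⟩ := exists_zero_on_path hG (u := 0) (v := 1)
        (f := fun r : ℝ => ((0 : ℂ), (-m * (1 - r) + r : ℂ), (1 - r : ℂ))) zero_le_one
        (by fun_prop) (by simpa using h) (by simpa using (h2 1 one_ne_zero).le)
      refine ⟨_, _, _, ?_, ?_, h⟩
      · intro h
        simp only [Prod.mk_eq_zero] at h
        obtain ⟨-, hb, hc⟩ := h
        rw [hc, mul_zero, zero_add] at hb
        simp [hb] at hc
      · simp
  · obtain ⟨t, ht, h⟩ := exists_zero_on_path hG (u := 0) (v := 1)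
        (f := fun r : ℝ => ((1 - r : ℂ) ^ 2, (-r * (m * (1 - r) + l * r) : ℂ), (r * (1 - r) : ℂ)))
        zero_le_one (by fun_prop) (by simpa using (h1 1 one_ne_zero).le)
        (by simpa using (h2 (-l) (by simpa using hl)).le)
    refine ⟨_, _, _, ?_, ?_, h⟩
    · intro h
      simp only [Prod.mk_eq_zero] at h
      have ht : (t : ℂ) = 1 := by
        have := pow_eq_zero_iff (two_ne_zero) |>.1 h.1
        linear_combination -this
      simp [ht, hl] at h
    · simp; ring

theorem exists_common_zero_reduced (k m l : ℂ) (G : ℂ × ℂ × ℂ → ℝ) (hG : Continuous G)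
    (h1 : ∀ a : ℂ, a ≠ 0 → 0 < G (a, 0, 0)) (h2 : ∀ b : ℂ, b ≠ 0 → G (0, b, 0) < 0) :
    ∃ a b c : ℂ, (a, b, c) ≠ 0 ∧
      conj a * b + m * (conj c * a) + k * (c * conj b) + l * (c * conj c) = 0 ∧
        G (a, b, c) = 0 := by
  by_cases hk : k = 0
  · subst hk
    simpa using exists_common_zero_of_vanishing m l G hG h1 h2
  obtain ⟨K, κ, hK, hκ, rfl⟩ : ∃ (K : ℝ) (κ : ℂ), 0 < K ∧ κ * conj κ = 1 ∧ k = K * κ := by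
    have hn : (‖k‖ : ℂ) ≠ 0 := by simpa using hk
    refine ⟨‖k‖, k / ‖k‖, by simpa using hk, ?_, by field_simp⟩
    rw [map_div₀, Complex.conj_ofReal, div_mul_div_comm, Complex.mul_conj,
      Complex.normSq_eq_norm_sq]
    push_cast
    field_simp
  obtain ⟨z, hz, hzi⟩ := exists_unit_im_eq_zero (m * conj κ ^ 2) (l * conj κ / K)
  have hz0 : z ≠ 0 := by rintro rfl; simp at hz
  have hκ0 : κ ≠ 0 := by rintro rfl; simp at hκ
  have hKc : (K : ℂ) ≠ 0 := by exact_mod_cast hK.ne'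
  -- Along `a = z² κ̄`, `c = t`, the first equation is solved by `b = z (P t + i Q t)`.
  set e : ℂ := z ^ 2 * conj κ with he
  have he0 : e ≠ 0 := mul_ne_zero (pow_ne_zero _ hz0) (by simpa using hκ0)
  set x : ℂ := z ^ 3 * conj κ ^ 2 * m with hx
  set y : ℂ := z * conj κ * l with hy
  have hxy : x.im = - y.im / K := by
    have : z * (m * conj κ ^ 2 * z ^ 2 + l * conj κ / K) = x + y / K := by
      rw [hx, hy]; ring
    rw [this, Complex.add_im, Complex.div_ofReal_im] at hzi
    rw [neg_div]; linarith
  set P : ℝ → ℝ := fun t => -t * (x.re + t * y.re) / (1 + t * K) with hP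
  set Q : ℝ → ℝ := fun t => t / K * y.im with hQ
  set b : ℝ → ℂ := fun t => z * (P t + Q t * Complex.I) with hb
  have hconjb : ∀ t, conj (b t) = conj z * (P t - Q t * Complex.I) := by
    intro t
    simp only [hb, map_mul, map_add, Complex.conj_ofReal, Complex.conj_I]
    ring
  have hbeq : ∀ t : ℝ, 0 ≤ t → (1 + t * K) * P t + (1 - t * K) * Q t * Complex.I
      = - t * (x + t * y) := by
    intro t ht
    have hpos : 1 + t * K ≠ 0 := by positivity
    apply Complex.ext
    · have : (1 + t * K) * P t = -t * (x.re + t * y.re) := by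
        rw [hP]; field_simp
      simpa using this
    · simp [hQ, hxy]
      field_simp
      ring
  have hsol : ∀ t : ℝ, 0 ≤ t → conj e * b t + m * (t * e) + K * κ * (t * conj (b t))
      + l * (t * t) = 0 := by
    intro t ht
    have h := hbeq t ht
    rw [hconjb, hb]
    simp only [he, map_mul, map_pow, Complex.conj_conj]
    have : (conj z * κ) * ((1 + t * K) * P t + (1 - t * K) * Q t * Complex.I +
        t * (x + t * y)) = 0 := by
      rw [h]; ring
    rw [hx, hy] at this
    linear_combination this + conj z * κ * (P t + Q t * Complex.I) * hz -
      (t ^ 2 * l + z ^ 2 * conj κ * m * t) * (κ * conj κ * hz + hκ)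
  have hT : 0 ≤ 1 / K := by positivity
  rcases le_total (G (e, b (1 / K), ((1 / K : ℝ) : ℂ))) 0 with h | h
  · have hcont : ContinuousOn (fun t : ℝ => (e, b t, (t : ℂ))) (Set.Icc 0 (1 / K)) := by
      have hPc : ContinuousOn P (Set.Icc 0 (1 / K)) := by
        apply ContinuousOn.div (by fun_prop) (by fun_prop)
        intro t ht
        have := ht.1
        positivity
      have hQc : Continuous Q := by fun_prop
      fun_prop
    obtain ⟨t, ht, h⟩ := exists_zero_on_path hG hT hcont
      (by simpa [hb, hP, hQ] using (h1 e he0).le) h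
    refine ⟨_, _, _, ?_, ?_, h⟩
    · simp [he0]
    · simpa using hsol t ht.1
  · obtain ⟨s, hs, h⟩ := exists_zero_on_path hG (u := 0) (v := 1)
      (f := fun s : ℝ => (e * (1 - s), b (1 / K) * (1 - s) + Complex.I * z * s,
        ((1 / K : ℝ) : ℂ) * (1 - s))) zero_le_one (by fun_prop) (by simpa using h)
      (by simpa using (h2 (Complex.I * z) (by simp [hz0])).le)
    refine ⟨_, _, _, ?_, ?_, h⟩
    · intro h
      simp only [Prod.mk_eq_zero] at h
      obtain ⟨ha, hb', -⟩ := h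
      have hs1 : (1 - s : ℂ) = 0 := (mul_eq_zero.1 ha).resolve_left he0
      rw [hs1, mul_zero, zero_add] at hb'
      have hs0 : (s : ℂ) = 0 := (mul_eq_zero.1 hb').resolve_left (by simp [hz0])
      simp [hs0] at hs1
    · have h0 := hsol _ hT
      have hcross : conj e * (Complex.I * z) + K * κ * (((1 / K : ℝ) : ℂ) *
          conj (Complex.I * z)) = 0 := by
        simp only [he, map_mul, map_pow, Complex.conj_conj, Complex.conj_I]
        push_cast
        field_simp
        linear_combination conj z * κ * Complex.I * hz
      simp only [map_mul, map_add, map_sub, map_one, Complex.conj_ofReal,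
        Complex.conj_I] at hcross ⊢
      linear_combination (1 - s : ℂ) ^ 2 * h0 + (1 - s : ℂ) * s * hcross

theorem exists_common_zero_form (d k m n p l : ℂ) (hd : d ≠ 0) (G : ℂ × ℂ × ℂ → ℝ)
    (hG : Continuous G)
    (h1 : ∀ a : ℂ, a ≠ 0 → 0 < G (a, 0, 0)) (h2 : ∀ b : ℂ, b ≠ 0 → G (0, b, 0) < 0) :
    ∃ a b c : ℂ, (a, b, c) ≠ 0 ∧
      d * (conj a * b) + m * (conj c * a) + n * (conj c * b) + p * (c * conj a) +
        k * (c * conj b) + l * (c * conj c) = 0 ∧ G (a, b, c) = 0 := by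
  have hd' : conj d ≠ 0 := by simpa using hd
  obtain ⟨a, b, c, hne, hF, hG⟩ := exists_common_zero_reduced (k / d) (m / d)
    ((l - n * p / d - m * conj n / conj d - k * conj p / conj d) / d)
    (fun x => G (x.1 - conj n / conj d * x.2.2, x.2.1 - p / d * x.2.2, x.2.2))
    (by fun_prop) (by simpa using h1) (by simpa using h2)
  refine ⟨_, _, _, ?_, ?_, hG⟩
  · intro h
    apply hne
    simp only [Prod.mk_eq_zero] at h ⊢
    obtain ⟨ha, hb, hc⟩ := h
    simpa [hc] using And.intro ha hb
  · simp only [map_sub, map_mul, map_div₀, Complex.conj_conj]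
    field_simp at hF ⊢
    linear_combination hF

/-- Three Hermitian forms on `ℂ³`, each with trace zero on the first coordinate plane, have a
common nontrivial zero. -/
theorem exists_common_zero_fin_three (K : Fin 3 → Matrix (Fin 3) (Fin 3) ℂ)
    (hK : ∀ j, (K j).IsHermitian) (htr : ∀ j, K j 0 0 + K j 1 1 = 0) :
    ∃ x : Fin 3 → ℂ, x ≠ 0 ∧ ∀ j, star x ⬝ᵥ K j *ᵥ x = 0 := by
  set κ : Fin 3 → ℝ := fun j => (K j 0 0).re with hκ
  set u : Fin 3 → ℝ := fun j => (K j 0 1).re with hu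
  set v : Fin 3 → ℝ := fun j => (K j 0 1).im with hv
  have h00 : ∀ j, K j 0 0 = κ j := fun j => ((hK j).coe_re_apply_self 0).symm
  have h11 : ∀ j, K j 1 1 = -κ j := fun j => by rw [← h00]; linear_combination htr j
  have h01 : ∀ j, K j 0 1 = u j + v j * Complex.I := fun j => (Complex.re_add_im _).symm
  have h10 : ∀ j, K j 1 0 = u j - v j * Complex.I := fun j => by
    rw [← (hK j).apply 1 0, h01]
    simp [sub_eq_add_neg]
  have hexp : ∀ j (a b c : ℂ), star ![a, b, c] ⬝ᵥ K j *ᵥ ![a, b, c] =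
      κ j * (a * conj a - b * conj b) + (u j + v j * Complex.I) * (conj a * b) +
        (u j - v j * Complex.I) * (a * conj b) + K j 2 0 * (conj c * a) + K j 2 1 * (conj c * b) +
        K j 0 2 * (c * conj a) + K j 1 2 * (c * conj b) + K j 2 2 * (c * conj c) := by
    intro j a b c
    simp [dotProduct, mulVec, Fin.sum_univ_three, h00, h01, h10, h11]
    ring
  by_cases hdet : (Matrix.of ![![κ 0, u 0, v 0], ![κ 1, u 1, v 1], ![κ 2, u 2, v 2]]).det = 0
  · obtain ⟨y, hy, hMy⟩ := Matrix.exists_mulVec_eq_zero_iff.2 hdet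
    have hcomb : ∃ p q r : ℝ, 0 ≤ p ∧ ¬ (p = 0 ∧ q = 0 ∧ r = 0) ∧
        ∀ j, κ j * p + u j * q + v j * r = 0 := by
      have hy0 : ¬ (y 0 = 0 ∧ y 1 = 0 ∧ y 2 = 0) := by
        rintro ⟨h0, h1, h2⟩
        apply hy
        ext i
        fin_cases i <;> assumption
      have hrow : ∀ j, κ j * y 0 + u j * y 1 + v j * y 2 = 0 := by
        intro j
        have := congrFun hMy j
        fin_cases j <;> simpa [mulVec, dotProduct, Fin.sum_univ_three] using this
      rcases le_total 0 (y 0) with h | h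
      · exact ⟨y 0, y 1, y 2, h, hy0, hrow⟩
      · refine ⟨-y 0, -y 1, -y 2, by linarith, by simpa using hy0, fun j => ?_⟩
        linear_combination -hrow j
    obtain ⟨p, q, r, hp, hne, hrow⟩ := hcomb
    set ρ : ℝ := √(p ^ 2 + q ^ 2 + r ^ 2) with hρ
    have hρ2 : ρ ^ 2 = p ^ 2 + q ^ 2 + r ^ 2 := Real.sq_sqrt (by positivity)
    have hρpos : 0 < ρ := by
      apply Real.sqrt_pos.2
      by_contra hcon
      apply hne
      refine ⟨?_, ?_, ?_⟩ <;> nlinarith [sq_nonneg p, sq_nonneg q, sq_nonneg r]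
    refine ⟨![((ρ + p : ℝ) : ℂ), q - r * Complex.I, 0], ?_, fun j => ?_⟩
    · intro h
      have := congrFun h 0
      simp only [cons_val_zero, Pi.zero_apply, Complex.ofReal_eq_zero] at this
      linarith
    · rw [hexp]
      have hrow' : (κ j * p + u j * q + v j * r : ℂ) = 0 := by exact_mod_cast hrow j
      have hρ2' : (ρ ^ 2 : ℂ) = p ^ 2 + q ^ 2 + r ^ 2 := by exact_mod_cast hρ2
      simp
      linear_combination 2 * (ρ + p : ℂ) * hrow' + κ j * hρ2' +
        (κ j * (r : ℂ) ^ 2 - 2 * v j * (ρ + p) * r) * Complex.I_sq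
  · set Δ : ℝ := (Matrix.of ![![κ 0, u 0, v 0], ![κ 1, u 1, v 1], ![κ 2, u 2, v 2]]).det with hΔ
    rw [Matrix.det_fin_three] at hΔ
    simp at hΔ
    set s : Fin 3 → ℝ :=
      ![κ 1 * u 2 - κ 2 * u 1, κ 2 * u 0 - κ 0 * u 2, κ 0 * u 1 - κ 1 * u 0] with hs
    set t : Fin 3 → ℝ :=
      ![κ 1 * v 2 - κ 2 * v 1, κ 2 * v 0 - κ 0 * v 2, κ 0 * v 1 - κ 1 * v 0] with ht
    set N : ℝ := κ 0 ^ 2 + κ 1 ^ 2 + κ 2 ^ 2 with hN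
    have hNpos : 0 < N := by
      by_contra hcon
      have h0 : κ 0 = 0 := by nlinarith [sq_nonneg (κ 0), sq_nonneg (κ 1), sq_nonneg (κ 2)]
      have h1 : κ 1 = 0 := by nlinarith [sq_nonneg (κ 0), sq_nonneg (κ 1), sq_nonneg (κ 2)]
      have h2 : κ 2 = 0 := by nlinarith [sq_nonneg (κ 0), sq_nonneg (κ 1), sq_nonneg (κ 2)]
      apply hdet
      rw [hΔ, h0, h1, h2]
      ring
    have hsolve : ∀ y : Fin 3 → ℝ, s 0 * y 0 + s 1 * y 1 + s 2 * y 2 = 0 →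
        t 0 * y 0 + t 1 * y 1 + t 2 * y 2 = 0 → κ 0 * y 0 + κ 1 * y 1 + κ 2 * y 2 = 0 → y = 0 := by
      intro y h1 h2 h3
      apply Matrix.eq_zero_of_mulVec_eq_zero
        (M := Matrix.of ![![s 0, s 1, s 2], ![t 0, t 1, t 2], ![κ 0, κ 1, κ 2]])
      · have : (Matrix.of ![![s 0, s 1, s 2], ![t 0, t 1, t 2], ![κ 0, κ 1, κ 2]]).det = Δ * N := by
          rw [Matrix.det_fin_three, hΔ, hN]
          simp [hs, ht]
          ring
        rw [this]
        exact mul_ne_zero hdet hNpos.ne'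
      · ext i
        fin_cases i <;> simpa [mulVec, dotProduct, Fin.sum_univ_three]
    -- `w` annihilates `κ` and `u - i v`.
    set w : Fin 3 → ℂ := fun j => s j - t j * Complex.I with hw
    have hd : ∑ j, w j * (u j + v j * Complex.I) ≠ 0 := by
      have : ∑ j, w j * (u j + v j * Complex.I) = 2 * Δ * Complex.I := by
        rw [Fin.sum_univ_three, hΔ, hw]
        simp [hs, ht]
        ring_nf
      rw [this]
      simpa using hdet
    obtain ⟨a, b, c, hne, hF, hG⟩ := exists_common_zero_form
      (∑ j, w j * (u j + v j * Complex.I)) (∑ j, w j * K j 1 2) (∑ j, w j * K j 2 0)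
      (∑ j, w j * K j 2 1) (∑ j, w j * K j 0 2) (∑ j, w j * K j 2 2) hd
      (fun x => ∑ j, κ j * (star ![x.1, x.2.1, x.2.2] ⬝ᵥ K j *ᵥ ![x.1, x.2.1, x.2.2]).re)
      (by simp only [hexp]; fun_prop)
      (by
        intro a ha
        have : 0 < N * Complex.normSq a := mul_pos hNpos (Complex.normSq_pos.2 ha)
        simp [hexp, Fin.sum_univ_three, Complex.mul_conj]
        rw [hN] at this
        linarith)
      (by
        intro b hb
        have : 0 < N * Complex.normSq b := mul_pos hNpos (Complex.normSq_pos.2 hb)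
        simp [hexp, Fin.sum_univ_three, Complex.mul_conj]
        rw [hN] at this
        linarith)
    refine ⟨![a, b, c], ?_, ?_⟩
    · intro h
      apply hne
      have h0 := congrFun h 0
      have h1 := congrFun h 1
      have h2 := congrFun h 2
      simp at h0 h1 h2
      simp [h0, h1, h2]
    set y : Fin 3 → ℝ := fun j => (star ![a, b, c] ⬝ᵥ K j *ᵥ ![a, b, c]).re with hy
    have hyc : ∀ j, star ![a, b, c] ⬝ᵥ K j *ᵥ ![a, b, c] = y j := fun j =>
      Complex.ext rfl (by simpa using (hK j).im_star_dotProduct_mulVec_self ![a, b, c])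
    have hwy : ∑ j, w j * y j = 0 := by
      rw [← hF]
      simp only [← hyc, hexp, Fin.sum_univ_three, hw, hs, ht]
      simp
      ring
    have hy0 : y = 0 := by
      rw [Fin.sum_univ_three] at hwy
      have hre := congrArg Complex.re hwy
      have him := congrArg Complex.im hwy
      rw [Fin.sum_univ_three] at hG
      simp [hw] at hre him
      exact hsolve y hre (by linarith) hG
    intro j
    rw [hyc, hy0]
    simp

theorem star_smul_dotProduct_mulVec_smul {ι : Type*} [Fintype ι] (M : Matrix ι ι ℂ) (a : ℂ)
    (y : ι → ℂ) : star (a • y) ⬝ᵥ M *ᵥ (a • y) = a * conj a * (star y ⬝ᵥ M *ᵥ y) := by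
  rw [star_smul, mulVec_smul, smul_dotProduct, dotProduct_smul]
  simp only [smul_eq_mul, RCLike.star_def]
  ring

theorem star_mulVec_dotProduct_mulVec {ι κ : Type*} [Fintype ι] [Fintype κ] (K : Matrix ι ι ℂ)
    (M : Matrix ι κ ℂ) (x : κ → ℂ) :
    star (M *ᵥ x) ⬝ᵥ K *ᵥ (M *ᵥ x) = star x ⬝ᵥ (Mᴴ * K * M) *ᵥ x := by
  rw [star_mulVec, ← dotProduct_mulVec, mulVec_mulVec, mulVec_mulVec, Matrix.mul_assoc]

/-- If three Hermitian forms on `ℂⁿ`, `n ≥ 3`, vanish simultaneously on a positive semidefinite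
matrix of rank at most two, they have a common nontrivial zero. -/
theorem exists_common_zero_of_add_eq_zero {n : ℕ} (hn : 3 ≤ n)
    (K : Fin 3 → Matrix (Fin n) (Fin n) ℂ) (hK : ∀ j, (K j).IsHermitian) (y₁ y₂ : Fin n → ℂ)
    (hne : y₁ ≠ 0 ∨ y₂ ≠ 0)
    (hsum : ∀ j, star y₁ ⬝ᵥ K j *ᵥ y₁ + star y₂ ⬝ᵥ K j *ᵥ y₂ = 0) :
    ∃ y : Fin n → ℂ, y ≠ 0 ∧ ∀ j, star y ⬝ᵥ K j *ᵥ y = 0 := by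
  by_cases h1 : y₁ = 0
  · subst h1
    exact ⟨y₂, by simpa using hne, fun j => by simpa using hsum j⟩
  by_cases hli : LinearIndependent ℂ ![y₁, y₂]
  · obtain ⟨z, hz⟩ := exists_linearIndependent_snoc_of_lt_finrank hli
      (by simpa using (by lia : 2 < n))
    set M : Matrix (Fin n) (Fin 3) ℂ :=
      (Matrix.of (Fin.snoc ![y₁, y₂] z : Fin 3 → Fin n → ℂ))ᵀ with hM
    have hinj : Function.Injective M.mulVec := Matrix.mulVec_injective_iff.2 hz
    have hM0 : M *ᵥ (Pi.single 0 1) = y₁ := by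
      rw [mulVec_single_one]
      rfl
    have hM1 : M *ᵥ (Pi.single 1 1) = y₂ := by
      rw [mulVec_single_one]
      rfl
    obtain ⟨x, hx, hxK⟩ := exists_common_zero_fin_three (fun j => Mᴴ * K j * M)
      (fun j => isHermitian_conjTranspose_mul_mul M (hK j))
      (by
        intro j
        have h := hsum j
        rw [← hM0, ← hM1, star_mulVec_dotProduct_mulVec, star_mulVec_dotProduct_mulVec] at h
        simpa [← Pi.single_star] using h)
    refine ⟨M *ᵥ x, fun h => hx (hinj (by rw [h, mulVec_zero])), fun j => ?_⟩
    rw [star_mulVec_dotProduct_mulVec]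
    exact hxK j
  · rw [LinearIndependent.pair_iff' h1] at hli
    push Not at hli
    obtain ⟨a, rfl⟩ := hli
    refine ⟨y₁, h1, fun j => ?_⟩
    have h := hsum j
    rw [star_smul_dotProduct_mulVec_smul, Complex.mul_conj] at h
    have hpos : ((1 + Complex.normSq a : ℝ) : ℂ) ≠ 0 := by
      have := Complex.normSq_nonneg a
      exact_mod_cast (by positivity : (1 + Complex.normSq a) ≠ 0)
    apply (mul_eq_zero.1 _).resolve_left hpos
    push_cast
    linear_combination h

/-- The joint numerical range of three Hermitian matrices of order at least three is convex. -/
theorem convex_jointNumericalRange {n : ℕ} (hn : 3 ≤ n)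
    (H : Fin 3 → Matrix (Fin n) (Fin n) ℂ) (hH : ∀ j, (H j).IsHermitian) :
    Convex ℝ {p : Fin 3 → ℝ | ∃ y : Fin n → ℂ, star y ⬝ᵥ y = 1 ∧
      ∀ j, star y ⬝ᵥ H j *ᵥ y = p j} := by
  rintro p ⟨y₁, hy₁, hp⟩ q ⟨y₂, hy₂, hq⟩ a b ha hb hab
  have hsq : ∀ {t : ℝ}, 0 ≤ t → (√t : ℂ) * conj (√t : ℂ) = t := by
    intro t ht
    rw [Complex.conj_ofReal]
    exact_mod_cast Real.mul_self_sqrt ht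
  have habc : (a + b : ℂ) = 1 := by exact_mod_cast hab
  have hexp : ∀ (j : Fin 3) (y : Fin n → ℂ),
      star y ⬝ᵥ (H j - ((a * p j + b * q j : ℝ) : ℂ) • (1 : Matrix (Fin n) (Fin n) ℂ)) *ᵥ y =
        star y ⬝ᵥ H j *ᵥ y - ((a * p j + b * q j : ℝ) : ℂ) * (star y ⬝ᵥ y) := by
    intro j y
    rw [sub_mulVec, dotProduct_sub, smul_mulVec, dotProduct_smul, one_mulVec, smul_eq_mul]
  obtain ⟨y, hy, hyK⟩ := exists_common_zero_of_add_eq_zero hn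
    (fun j => H j - ((a * p j + b * q j : ℝ) : ℂ) • (1 : Matrix (Fin n) (Fin n) ℂ))
    (fun j => by
      apply (hH j).sub
      rw [IsHermitian, conjTranspose_smul, conjTranspose_one]
      simp)
    ((√a : ℂ) • y₁) ((√b : ℂ) • y₂)
    (by
      by_contra! hcon
      have hy₁0 : y₁ ≠ 0 := by rintro rfl; simp at hy₁
      have hy₂0 : y₂ ≠ 0 := by rintro rfl; simp at hy₂
      obtain ⟨h1, h2⟩ := hcon
      simp only [smul_eq_zero, hy₁0, hy₂0, or_false, Complex.ofReal_eq_zero] at h1 h2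
      rw [Real.sqrt_eq_zero ha] at h1
      rw [Real.sqrt_eq_zero hb] at h2
      simp [h1, h2] at hab)
    (by
      intro j
      rw [star_smul_dotProduct_mulVec_smul, star_smul_dotProduct_mulVec_smul, hexp, hexp, hp, hq,
        hy₁, hy₂, hsq ha, hsq hb]
      push_cast
      linear_combination (-(a * p j + b * q j) : ℂ) * habc)
  obtain ⟨N, hNpos, hN⟩ : ∃ N : ℝ, 0 < N ∧ star y ⬝ᵥ y = N := by
    have hpos := dotProduct_star_self_pos_iff.2 hy
    rw [Complex.lt_def] at hpos
    exact ⟨_, hpos.1, Complex.ext rfl hpos.2.symm⟩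
  have hscale : ∀ (M : Matrix (Fin n) (Fin n) ℂ), star ((√(N⁻¹) : ℂ) • y) ⬝ᵥ
      M *ᵥ ((√(N⁻¹) : ℂ) • y) = (N : ℂ)⁻¹ * (star y ⬝ᵥ M *ᵥ y) := by
    intro M
    rw [star_smul_dotProduct_mulVec_smul, hsq (by positivity)]
    push_cast
    rfl
  have hNc : (N : ℂ) ≠ 0 := by exact_mod_cast hNpos.ne'
  refine ⟨(√(N⁻¹) : ℂ) • y, ?_, fun j => ?_⟩
  · have := hscale 1
    rw [one_mulVec, one_mulVec, hN] at this
    rw [this]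
    field_simp
  · have h := hyK j
    rw [hexp, hN] at h
    rw [hscale]
    simp only [Pi.add_apply, Pi.smul_apply, smul_eq_mul]
    field_simp
    linear_combination h

theorem isCompact_unitVectors (n : ℕ) : IsCompact {y : Fin n → ℂ | star y ⬝ᵥ y = 1} := by
  apply Metric.isCompact_of_isClosed_isBounded
  · apply isClosed_eq _ continuous_const
    unfold dotProduct
    fun_prop
  · rw [isBounded_iff_forall_norm_le]
    refine ⟨1, fun y hy => (pi_norm_le_iff_of_nonneg zero_le_one).2 fun i => ?_⟩
    have h : ∑ i, ‖y i‖ ^ 2 = 1 := by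
      have : ((∑ i, ‖y i‖ ^ 2 : ℝ) : ℂ) = 1 := by
        rw [← show star y ⬝ᵥ y = 1 from hy]
        simp [dotProduct, Complex.conj_mul']
      exact_mod_cast this
    have := Finset.single_le_sum (f := fun i => ‖y i‖ ^ 2) (fun i _ => by positivity)
      (Finset.mem_univ i)
    rw [h] at this
    exact (sq_le_one_iff₀ (norm_nonneg _)).1 this

/-- A compact convex set missing the closed nonpositive orthant is separated from it by a
nonnegative functional. -/
theorem exists_nonneg_combination_pos {ι : Type*} [Fintype ι] [DecidableEq ι] {s : Set (ι → ℝ)}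
    (hconv : Convex ℝ s) (hcomp : IsCompact s) (hs : ∀ a ∈ s, ∃ i, 0 < a i) :
    ∃ k : ι → ℝ, (∀ i, 0 ≤ k i) ∧ ∀ a ∈ s, 0 < ∑ i, k i * a i := by
  have hdisj : Disjoint s (Set.Iic 0) := by
    rw [Set.disjoint_left]
    intro a ha hle
    obtain ⟨i, hi⟩ := hs a ha
    exact absurd (hle i) (not_le.2 hi)
  obtain ⟨f, u, v, hfu, huv, hfv⟩ :=
    geometric_hahn_banach_compact_closed hconv hcomp (convex_Iic 0) isClosed_Iic hdisj
  have hv : v < 0 := by simpa using hfv 0 (by simp)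
  refine ⟨fun i => -f (Pi.single i 1), fun i => ?_, fun a ha => ?_⟩
  · by_contra! hcon
    have hpos : 0 < f (Pi.single i 1) := by linarith
    have := hfv ((v / f (Pi.single i 1)) • Pi.single i 1) (by
      intro j
      have hle : v / f (Pi.single i 1) ≤ 0 := (div_neg_of_neg_of_pos hv hpos).le
      by_cases hj : j = i
      · subst hj; simpa using hle
      · simp [hj])
    rw [map_smul, smul_eq_mul, div_mul_cancel₀ _ hpos.ne'] at this
    exact lt_irrefl _ this
  · have hfa : f a = ∑ i, a i * f (Pi.single i 1) := by
      conv_lhs => rw [pi_eq_sum_univ' a]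
      simp [map_sum]
    have := hfu a ha
    have hneg : ∑ i, -f (Pi.single i 1) * a i = - f a := by
      rw [hfa, ← Finset.sum_neg_distrib]
      exact Finset.sum_congr rfl fun i _ => by ring
    rw [hneg]
    linarith

/-- Weights exhibiting a point of the Davis–Wielandt shell of a sectored disk as a combination of
`0` and two boundary points `ρ (c ± i s)`. -/
theorem exists_sector_weights {γ θ N r ξ υ : ℝ} (hcos : 0 < Real.cos θ) (hcos1 : Real.cos θ < 1)
    (hγ : 0 < γ) (hN : 0 < N) (hr : 0 < r) (hξ : 0 < ξ) (hcs : ξ ^ 2 + υ ^ 2 < r * N)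
    (h1 : r ≤ γ ^ 2 * N) (h4 : r * Real.cos θ ≤ γ * ξ)
    (h2 : Real.cos θ * |υ| ≤ Real.sin θ * ξ) :
    ∃ ρ c s p₀ p₁ p₂ : ℝ, 0 < ρ ∧ ρ ≤ γ ∧ Real.cos θ ≤ c ∧ 0 ≤ s ∧ c ^ 2 + s ^ 2 = 1 ∧
      0 ≤ p₀ ∧ 0 ≤ p₁ ∧ 0 ≤ p₂ ∧ p₀ + p₁ + p₂ = N ∧ ρ * c * (p₁ + p₂) = ξ ∧
      ρ * s * (p₁ - p₂) = υ ∧ ρ ^ 2 * (p₁ + p₂) = r := by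
  obtain ⟨ρ, hρ, hργ, hρN, hρξ, hρS, hρlt⟩ : ∃ ρ : ℝ, 0 < ρ ∧ ρ ≤ γ ∧ r ≤ ρ ^ 2 * N ∧
      r * Real.cos θ ≤ ρ * ξ ∧ ρ ^ 2 * (ξ ^ 2 + υ ^ 2) ≤ r ^ 2 ∧ ρ * ξ < r := by
    have hq : 0 < √(r / N) := Real.sqrt_pos.2 (by positivity)
    have hq2 : √(r / N) ^ 2 = r / N := Real.sq_sqrt (by positivity)
    have hqγ : √(r / N) ≤ γ := by
      apply Real.sqrt_le_iff.2 ⟨hγ.le, _⟩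
      rwa [div_le_iff₀ hN]
    have hqS : √(r / N) ^ 2 * (ξ ^ 2 + υ ^ 2) < r ^ 2 := by
      rw [hq2, div_mul_eq_mul_div, div_lt_iff₀ hN]
      nlinarith
    rcases le_total (r * Real.cos θ) (√(r / N) * ξ) with h | h
    · refine ⟨√(r / N), hq, hqγ, ?_, h, hqS.le, ?_⟩
      · rw [hq2]; field_simp; exact le_rfl
      · apply lt_of_pow_lt_pow_left₀ 2 hr.le
        nlinarith [mul_nonneg (sq_nonneg √(r / N)) (sq_nonneg υ)]
    · have hle : √(r / N) ≤ r * Real.cos θ / ξ := by rwa [le_div_iff₀ hξ]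
      have hρξ : r * Real.cos θ / ξ * ξ = r * Real.cos θ := by field_simp
      refine ⟨r * Real.cos θ / ξ, by positivity, ?_, ?_, hρξ.ge, ?_, ?_⟩
      · rwa [div_le_iff₀ hξ]
      · have : r / N ≤ (r * Real.cos θ / ξ) ^ 2 := by
          rw [← hq2]; gcongr
        rwa [div_le_iff₀ hN] at this
      · have hsec : Real.cos θ ^ 2 * (ξ ^ 2 + υ ^ 2) ≤ ξ ^ 2 := by
          have := pow_le_pow_left₀ (by positivity) h2 2
          rw [mul_pow, mul_pow, sq_abs, Real.sin_sq] at this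
          linarith
        have : (r * Real.cos θ / ξ) ^ 2 * (ξ ^ 2 + υ ^ 2) =
            r ^ 2 * (Real.cos θ ^ 2 * (ξ ^ 2 + υ ^ 2)) / ξ ^ 2 := by
          field_simp
        rw [this, div_le_iff₀ (by positivity)]
        gcongr
      · rw [hρξ]; nlinarith
  have hc1 : ρ * ξ / r < 1 := by rwa [div_lt_one hr]
  have hc0 : 0 < ρ * ξ / r := by positivity
  have hs2pos : 0 < 1 - (ρ * ξ / r) ^ 2 := by nlinarith
  set s : ℝ := √(1 - (ρ * ξ / r) ^ 2) with hs
  have hspos : 0 < s := Real.sqrt_pos.2 hs2pos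
  have hs2 : s ^ 2 = 1 - (ρ * ξ / r) ^ 2 := Real.sq_sqrt hs2pos.le
  have hΔ : |υ / (ρ * s)| ≤ r / ρ ^ 2 := by
    rw [abs_div, abs_of_pos (mul_pos hρ hspos), div_le_div_iff₀ (by positivity) (by positivity)]
    apply le_of_sq_le_sq _ (by positivity)
    rw [mul_pow, sq_abs, mul_pow, mul_pow, hs2]
    have hr2 : r ^ 2 * (1 - (ρ * ξ / r) ^ 2) = r ^ 2 - ρ ^ 2 * ξ ^ 2 := by field_simp
    nlinarith [mul_nonneg (sq_nonneg ρ) (by linarith : 0 ≤ r ^ 2 - ρ ^ 2 * (ξ ^ 2 + υ ^ 2))]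
  obtain ⟨hΔ1, hΔ2⟩ := abs_le.1 hΔ
  refine ⟨ρ, ρ * ξ / r, s, N - r / ρ ^ 2, (r / ρ ^ 2 + υ / (ρ * s)) / 2,
    (r / ρ ^ 2 - υ / (ρ * s)) / 2, hρ, hργ, ?_, hspos.le, ?_, ?_, ?_, ?_, ?_, ?_, ?_, ?_⟩
  · rw [le_div_iff₀ hr]; linarith
  · rw [hs2]; ring
  · rw [sub_nonneg, div_le_iff₀ (by positivity)]; linarith
  · linarith
  · linarith
  · ring
  · field_simp; ring
  · field_simp; ring
  · field_simp; ring

/-- Families of vectors with equal Gram matrices are related by a unitary matrix. -/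
theorem exists_unitary_mul_eq {ι κ : Type*} [Fintype ι] [DecidableEq ι] [Fintype κ]
    (V W : Matrix ι κ ℂ) (hW : Function.Injective W.mulVec) (h : Vᴴ * V = Wᴴ * W) :
    ∃ U : Matrix ι ι ℂ, Uᴴ * U = 1 ∧ U * V = W := by
  have hgram : ∀ c, star (V *ᵥ c) ⬝ᵥ (V *ᵥ c) = star (W *ᵥ c) ⬝ᵥ (W *ᵥ c) := by
    intro c
    have h1 := star_mulVec_dotProduct_mulVec 1 V c
    have h2 := star_mulVec_dotProduct_mulVec 1 W c
    rw [one_mulVec, Matrix.mul_one] at h1 h2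
    rw [h1, h2, h]
  have hV : Function.Injective V.mulVec := by
    rw [← Matrix.coe_mulVecLin, injective_iff_map_eq_zero]
    intro c hc
    rw [mulVecLin_apply] at hc
    have hz := hgram c
    rw [hc, star_zero, zero_dotProduct] at hz
    exact hW ((dotProduct_star_self_eq_zero.1 hz.symm).trans (mulVec_zero W).symm)
  set e := (WithLp.linearEquiv 2 ℂ (ι → ℂ)).symm with he
  set T : (κ → ℂ) →ₗ[ℂ] EuclideanSpace ℂ ι := e.toLinearMap ∘ₗ V.mulVecLin with hT
  set S : (κ → ℂ) →ₗ[ℂ] EuclideanSpace ℂ ι := e.toLinearMap ∘ₗ W.mulVecLin with hS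
  have hTinj : Function.Injective T := e.injective.comp hV
  have hnorm : ∀ c, ‖S c‖ = ‖T c‖ := by
    intro c
    rw [@norm_eq_sqrt_re_inner ℂ, @norm_eq_sqrt_re_inner ℂ]
    congr 2
    have := hgram c
    simp only [EuclideanSpace.inner_eq_star_dotProduct]
    rw [dotProduct_comm, dotProduct_comm (T c).ofLp]
    exact this.symm
  let L : LinearMap.range T →ₗᵢ[ℂ] EuclideanSpace ℂ ι :=
    { toLinearMap := S ∘ₗ (LinearEquiv.ofInjective T hTinj).symm.toLinearMap
      norm_map' := by
        intro x
        obtain ⟨c, rfl⟩ := (LinearEquiv.ofInjective T hTinj).surjective x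
        simp only [LinearMap.comp_apply, LinearEquiv.coe_coe, LinearEquiv.symm_apply_apply]
        rw [hnorm]
        rfl }
  have hLT : ∀ c, L.extend (T c) = S c := by
    intro c
    have := L.extend_apply (LinearEquiv.ofInjective T hTinj c)
    simpa [L] using this
  set U : Matrix ι ι ℂ := LinearMap.toMatrix' (e.symm.toLinearMap ∘ₗ L.extend.toLinearMap ∘ₗ
    e.toLinearMap) with hU
  have hUapp : ∀ x, U *ᵥ x = e.symm (L.extend (e x)) := by
    intro x
    rw [hU, LinearMap.toMatrix'_mulVec]
    rfl
  refine ⟨U, ?_, ?_⟩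
  · have hinner : ∀ x y, star (U *ᵥ x) ⬝ᵥ (U *ᵥ y) = star x ⬝ᵥ y := by
      intro x y
      have := L.extend.inner_map_map (e x) (e y)
      simp only [EuclideanSpace.inner_eq_star_dotProduct] at this
      rw [dotProduct_comm, dotProduct_comm (e y).ofLp] at this
      rw [hUapp, hUapp]
      exact this
    ext i j
    have := hinner (Pi.single i 1) (Pi.single j 1)
    rw [star_mulVec, ← dotProduct_mulVec, mulVec_mulVec] at this
    simpa [← Pi.single_star, Matrix.one_apply, Pi.single_apply, eq_comm] using this
  · classical
    refine Matrix.ext_of_mulVec_single fun i => ?_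
    rw [← mulVec_mulVec, hUapp]
    exact congrArg e.symm (hLT _)

theorem Hpart_isHermitian {n : ℕ} (A : Matrix (Fin n) (Fin n) ℂ) : (Hpart A).IsHermitian := by
  rw [IsHermitian, Hpart, conjTranspose_smul, conjTranspose_add, conjTranspose_conjTranspose,
    add_comm]
  simp

theorem Hpart_unitary_diagonal {n : ℕ} (U : Matrix (Fin n) (Fin n) ℂ) (c : ℂ) (z : Fin n → ℂ) :
    Hpart (c • (U * diagonal z * Uᴴ)) = U * diagonal (fun i => ((c * z i).re : ℂ)) * Uᴴ := by
  have hdiag : diagonal (fun i => ((c * z i).re : ℂ)) =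
      (2⁻¹ : ℂ) • (c • diagonal z + star c • (diagonal z)ᴴ) := by
    rw [diagonal_conjTranspose]
    ext i j
    by_cases hij : i = j
    · subst hij
      simp only [diagonal_apply_eq, Matrix.smul_apply, Matrix.add_apply, smul_eq_mul, Pi.star_apply,
        RCLike.star_def]
      rw [Complex.re_eq_add_conj, map_mul]
      ring
    · simp [hij]
  rw [hdiag, Hpart, conjTranspose_smul, conjTranspose_mul, conjTranspose_mul,
    conjTranspose_conjTranspose, Matrix.mul_smul, Matrix.smul_mul, Matrix.mul_add, Matrix.add_mul,
    Matrix.mul_smul, Matrix.smul_mul, Matrix.mul_smul, Matrix.smul_mul,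
    Matrix.mul_assoc U (diagonal z)ᴴ]

/-- The matrix with unitary factor `U` and eigenvalues `z i` in the sectored disk of half-angle `θ`
satisfies the three semidefiniteness conditions. -/
theorem posSemidef_unitary_diagonal {n : ℕ} {U : Matrix (Fin n) (Fin n) ℂ} (hU : Uᴴ * U = 1)
    {γ : ℝ} {u w : ℂ} {z : Fin n → ℂ} (hz : ∀ i, Complex.normSq (z i) ≤ γ ^ 2)
    (hu : ∀ i, 0 ≤ (u * z i).re) (hw : ∀ i, 0 ≤ (w * z i).re) :
    (((γ ^ 2 : ℝ) : ℂ) • (1 : Matrix (Fin n) (Fin n) ℂ) -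
      (U * diagonal z * Uᴴ)ᴴ * (U * diagonal z * Uᴴ)).PosSemidef ∧
    (Hpart (u • (U * diagonal z * Uᴴ))).PosSemidef ∧
    (Hpart (w • (U * diagonal z * Uᴴ))).PosSemidef := by
  refine ⟨?_, ?_, ?_⟩
  · have hU' : U * Uᴴ = 1 := mul_eq_one_comm.1 hU
    have : ((γ ^ 2 : ℝ) : ℂ) • (1 : Matrix (Fin n) (Fin n) ℂ) -
        (U * diagonal z * Uᴴ)ᴴ * (U * diagonal z * Uᴴ) =
        U * diagonal (fun i => ((γ ^ 2 - Complex.normSq (z i) : ℝ) : ℂ)) * Uᴴ := by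
      have hdiag : diagonal (fun i => ((γ ^ 2 - Complex.normSq (z i) : ℝ) : ℂ)) =
          ((γ ^ 2 : ℝ) : ℂ) • (1 : Matrix (Fin n) (Fin n) ℂ) - (diagonal z)ᴴ * diagonal z := by
        rw [diagonal_conjTranspose, diagonal_mul_diagonal, smul_one_eq_diagonal, diagonal_sub]
        congr 1
        ext i
        simp [Complex.normSq_eq_conj_mul_self]
      rw [hdiag, Matrix.mul_sub, Matrix.sub_mul, Matrix.mul_smul, Matrix.smul_mul, Matrix.mul_one,
        hU', conjTranspose_mul, conjTranspose_mul, conjTranspose_conjTranspose]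
      congr 1
      simp only [Matrix.mul_assoc]
      rw [← Matrix.mul_assoc Uᴴ U, hU, Matrix.one_mul]
    rw [this]
    apply PosSemidef.mul_mul_conjTranspose_same
    exact PosSemidef.diagonal fun i => by
      simpa [← Complex.ofReal_pow, ← Complex.ofReal_sub] using hz i
  · rw [Hpart_unitary_diagonal]
    apply PosSemidef.mul_mul_conjTranspose_same
    exact PosSemidef.diagonal fun i => Complex.zero_le_real.2 (hu i)
  · rw [Hpart_unitary_diagonal]
    apply PosSemidef.mul_mul_conjTranspose_same
    exact PosSemidef.diagonal fun i => Complex.zero_le_real.2 (hw i)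

theorem re_sin_add_cos_mul (θ : ℝ) (z : ℂ) :
    ((Real.sin θ + Real.cos θ * Complex.I) * z).re = Real.sin θ * z.re - Real.cos θ * z.im := by
  simp [-Complex.ofReal_sin, -Complex.ofReal_cos]

theorem re_sin_sub_cos_mul (θ : ℝ) (z : ℂ) :
    ((Real.sin θ - Real.cos θ * Complex.I) * z).re = Real.sin θ * z.re + Real.cos θ * z.im := by
  simp [-Complex.ofReal_sin, -Complex.ofReal_cos]

theorem star_dotProduct_self_eq_ofReal {ι : Type*} [Fintype ι] (x : ι → ℂ) :
    star x ⬝ᵥ x = ((star x ⬝ᵥ x).re : ℂ) :=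
  Complex.ext rfl (Complex.le_def.1 (dotProduct_star_self_nonneg x)).2.symm

theorem re_star_dotProduct_self_pos {ι : Type*} [Fintype ι] {x : ι → ℂ} (hx : x ≠ 0) :
    0 < (star x ⬝ᵥ x).re :=
  (Complex.lt_def.1 (dotProduct_star_self_pos_iff.2 hx)).1

/-- Strict Cauchy–Schwarz inequality for independent vectors. -/
theorem normSq_star_dotProduct_lt {ι : Type*} [Fintype ι] {x y : ι → ℂ} (hx : x ≠ 0)
    (hxy : ∀ a : ℂ, a • x ≠ y) :
    Complex.normSq (star x ⬝ᵥ y) < (star y ⬝ᵥ y).re * (star x ⬝ᵥ x).re := by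
  have hN := re_star_dotProduct_self_pos hx
  have hxx := star_dotProduct_self_eq_ofReal x
  have hyy := star_dotProduct_self_eq_ofReal y
  have hyx : star y ⬝ᵥ x = conj (star x ⬝ᵥ y) := star_dotProduct _ _
  set N := (star x ⬝ᵥ x).re
  set r := (star y ⬝ᵥ y).re
  set S := star x ⬝ᵥ y
  have hNc : (N : ℂ) ≠ 0 := by exact_mod_cast hN.ne'
  have hw : (N : ℂ) • y - S • x ≠ 0 := by
    intro h
    apply hxy (S / N)
    rw [sub_eq_zero] at h
    rw [div_eq_inv_mul, mul_smul, ← h, smul_smul, inv_mul_cancel₀ hNc, one_smul]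
  have hpos := re_star_dotProduct_self_pos hw
  have hval : star ((N : ℂ) • y - S • x) ⬝ᵥ ((N : ℂ) • y - S • x) =
      ((N * (r * N - Complex.normSq S) : ℝ) : ℂ) := by
    simp only [star_sub, star_smul, sub_dotProduct, dotProduct_sub, smul_dotProduct,
      dotProduct_smul, smul_eq_mul, hxx, hyy, hyx, RCLike.star_def, Complex.conj_ofReal]
    push_cast
    rw [← Complex.mul_conj]
    ring
  rw [hval, Complex.ofReal_re] at hpos
  nlinarith [pos_of_mul_pos_right hpos hN.le]

/-- Interpolation: a sectored-disk matrix sending `x` to `y`. -/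
theorem exists_sectored_mulVec_eq {n : ℕ} (hn : 3 ≤ n) {γ θ : ℝ} (hγ : 0 < γ)
    (hθ₀ : 0 < θ) (hθ₁ : θ < Real.pi / 2) {x y : Fin n → ℂ} (hx : x ≠ 0) (hy : y ≠ 0)
    (h1 : (star y ⬝ᵥ y).re ≤ γ ^ 2 * (star x ⬝ᵥ x).re)
    (h2 : 0 ≤ ((Real.sin θ + Real.cos θ * Complex.I) * (star x ⬝ᵥ y)).re)
    (h3 : 0 ≤ ((Real.sin θ - Real.cos θ * Complex.I) * (star x ⬝ᵥ y)).re)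
    (h4 : (star y ⬝ᵥ y).re * Real.cos θ ≤ γ * (star x ⬝ᵥ y).re) :
    ∃ B : Matrix (Fin n) (Fin n) ℂ,
      ((((γ ^ 2 : ℝ) : ℂ) • (1 : Matrix (Fin n) (Fin n) ℂ) - Bᴴ * B).PosSemidef ∧
      (Hpart ((Real.sin θ + Real.cos θ * Complex.I : ℂ) • B)).PosSemidef ∧
      (Hpart ((Real.sin θ - Real.cos θ * Complex.I : ℂ) • B)).PosSemidef) ∧ B *ᵥ x = y := by
  have hcos : 0 < Real.cos θ := Real.cos_pos_of_mem_Ioo ⟨by linarith, hθ₁⟩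
  have hsin : 0 < Real.sin θ := Real.sin_pos_of_pos_of_lt_pi hθ₀ (by linarith [Real.pi_pos])
  have hsc := Real.sin_sq_add_cos_sq θ
  have hcos1 : Real.cos θ < 1 := by nlinarith
  have hN := re_star_dotProduct_self_pos hx
  have hr := re_star_dotProduct_self_pos hy
  by_cases hdep : ∃ a : ℂ, a • x = y
  · obtain ⟨a, rfl⟩ := hdep
    have hS : star x ⬝ᵥ (a • x) = ((star x ⬝ᵥ x).re : ℂ) * a := by
      rw [dotProduct_smul, smul_eq_mul, mul_comm, ← star_dotProduct_self_eq_ofReal]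
    have hR : (star (a • x) ⬝ᵥ (a • x)).re = Complex.normSq a * (star x ⬝ᵥ x).re := by
      rw [star_smul, smul_dotProduct, hS, smul_eq_mul, RCLike.star_def, mul_left_comm,
        ← Complex.normSq_eq_conj_mul_self, mul_comm, ← Complex.ofReal_mul, Complex.ofReal_re]
    rw [hS, mul_left_comm, Complex.re_ofReal_mul] at h2 h3
    rw [hR] at h1
    refine ⟨1 * diagonal (fun _ => a) * (1 : Matrix (Fin n) (Fin n) ℂ)ᴴ,
      posSemidef_unitary_diagonal (by simp) (fun _ => le_of_mul_le_mul_right h1 hN)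
        (fun _ => nonneg_of_mul_nonneg_right h2 hN) (fun _ => nonneg_of_mul_nonneg_right h3 hN), ?_⟩
    rw [conjTranspose_one, Matrix.one_mul, Matrix.mul_one, ← smul_one_eq_diagonal, smul_mulVec,
      one_mulVec]
  · push Not at hdep
    have hcs := normSq_star_dotProduct_lt hx hdep
    have hyx : star y ⬝ᵥ x = conj (star x ⬝ᵥ y) := star_dotProduct _ _
    have hξ : 0 < (star x ⬝ᵥ y).re := pos_of_mul_pos_right ((mul_pos hr hcos).trans_le h4) hγ.le
    rw [re_sin_add_cos_mul] at h2
    rw [re_sin_sub_cos_mul] at h3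
    rw [Complex.normSq_apply] at hcs
    obtain ⟨ρ, c, s, p₀, p₁, p₂, hρ, hργ, hc, hs, hcs1, hp₀, hp₁, hp₂, hpN, hpξ, hpυ, hpr⟩ :=
      exists_sector_weights (υ := (star x ⬝ᵥ y).im) hcos hcos1 hγ hN hr hξ (by nlinarith) h1 h4
        (by rw [← abs_of_pos hcos, ← abs_mul, abs_le]; constructor <;> linarith)
    have hxx := star_dotProduct_self_eq_ofReal x
    have hyy := star_dotProduct_self_eq_ofReal y
    have hxy := (Complex.re_add_im (star x ⬝ᵥ y)).symm
    rw [← hpN] at hxx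
    rw [← hpr] at hyy
    rw [← hpξ, ← hpυ] at hxy
    obtain ⟨m, rfl⟩ := Nat.exists_eq_add_of_le' hn
    have hs1 : s ≤ Real.sin θ := by
      apply le_of_sq_le_sq _ hsin.le
      nlinarith
    have hsq : ∀ {t : ℝ}, 0 ≤ t → (√t : ℂ) * √t = t := fun ht => by
      exact_mod_cast Real.mul_self_sqrt ht
    set zp : ℂ := ρ * (c + s * Complex.I) with hzp
    set zm : ℂ := ρ * (c - s * Complex.I) with hzm
    set z : Fin (m + 3) → ℂ := Fin.cons 0 (Fin.cons zp (Fin.cons zm 0)) with hz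
    set x₀ : Fin (m + 3) → ℂ := Fin.cons (√p₀ : ℂ) (Fin.cons (√p₁ : ℂ) (Fin.cons (√p₂ : ℂ) 0))
      with hx₀
    set y₀ : Fin (m + 3) → ℂ := diagonal z *ᵥ x₀ with hy₀
    have hzall : ∀ P : ℂ → Prop, P 0 → P zp → P zm → ∀ i, P (z i) := by
      intro P h0 hp hm i
      refine Fin.cases h0 (fun i => Fin.cases hp (fun i => Fin.cases hm (fun i => ?_) i) i) i
      simpa [hz] using h0
    have hxx₀ : star x₀ ⬝ᵥ x₀ = star x ⬝ᵥ x := by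
      rw [hxx]
      simp [hx₀, dotProduct, Fin.sum_univ_succ, hsq, hp₀, hp₁, hp₂, add_assoc]
    have hxy₀ : star x₀ ⬝ᵥ y₀ = star x ⬝ᵥ y := by
      rw [hxy]
      simp [hy₀, hx₀, hz, dotProduct, Fin.sum_univ_succ, mulVec_diagonal, hzp, hzm]
      linear_combination ((ρ : ℂ) * (c + s * Complex.I)) * hsq hp₁ +
        ((ρ : ℂ) * (c - s * Complex.I)) * hsq hp₂
    have hyx₀ : star y₀ ⬝ᵥ x₀ = star y ⬝ᵥ x := by
      rw [hyx, ← hxy₀]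
      exact star_dotProduct _ _
    have hyy₀ : star y₀ ⬝ᵥ y₀ = star y ⬝ᵥ y := by
      rw [hyy]
      have hcs' : (c ^ 2 + s ^ 2 : ℂ) = 1 := by exact_mod_cast hcs1
      simp [hy₀, hx₀, hz, dotProduct, Fin.sum_univ_succ, mulVec_diagonal, hzp, hzm]
      linear_combination (ρ : ℂ) ^ 2 * (c ^ 2 + s ^ 2) * (hsq hp₁ + hsq hp₂) +
        (ρ : ℂ) ^ 2 * (p₁ + p₂) * hcs' -
          (ρ : ℂ) ^ 2 * s ^ 2 * (√p₁ * √p₁ + √p₂ * √p₂) * Complex.I_sq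
    obtain ⟨U, hU, hUV⟩ := exists_unitary_mul_eq (Matrix.of ![x₀, y₀])ᵀ (Matrix.of ![x, y])ᵀ
      (Matrix.mulVec_injective_iff.2 ((LinearIndependent.pair_iff' hx).2 hdep))
      (by
        ext i j
        fin_cases i <;> fin_cases j
        · exact hxx₀
        · exact hxy₀
        · exact hyx₀
        · exact hyy₀)
    have hUx : U *ᵥ x₀ = x := by
      ext i
      exact congrFun (congrFun hUV i) 0
    have hUy : U *ᵥ y₀ = y := by
      ext i
      exact congrFun (congrFun hUV i) 1
    refine ⟨U * diagonal z * Uᴴ, posSemidef_unitary_diagonal hU ?_ ?_ ?_, ?_⟩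
    · have hle : ρ ^ 2 ≤ γ ^ 2 := by gcongr
      have hnp : Complex.normSq zp = ρ ^ 2 * (c ^ 2 + s ^ 2) := by
        simp [hzp, Complex.normSq_apply]; ring
      have hnm : Complex.normSq zm = ρ ^ 2 * (c ^ 2 + s ^ 2) := by
        simp [hzm, Complex.normSq_apply]; ring
      refine hzall (fun z => Complex.normSq z ≤ γ ^ 2) (by simp; positivity) ?_ ?_
      · rw [hnp, hcs1, mul_one]; exact hle
      · rw [hnm, hcs1, mul_one]; exact hle
    · refine hzall (fun z => 0 ≤ ((Real.sin θ + Real.cos θ * Complex.I) * z).re) (by simp) ?_ ?_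
      · rw [re_sin_add_cos_mul]
        simp [hzp, -Complex.ofReal_sin, -Complex.ofReal_cos]
        nlinarith [mul_le_mul hc hs1 hs (hcos.le.trans hc)]
      · rw [re_sin_add_cos_mul]
        simp [hzm, -Complex.ofReal_sin, -Complex.ofReal_cos]
        have := hcos.le.trans hc
        have : 0 ≤ Real.sin θ * (ρ * c) + Real.cos θ * (ρ * s) := by positivity
        linarith
    · refine hzall (fun z => 0 ≤ ((Real.sin θ - Real.cos θ * Complex.I) * z).re) (by simp) ?_ ?_
      · rw [re_sin_sub_cos_mul]
        simp [hzp, -Complex.ofReal_sin, -Complex.ofReal_cos]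
        have := hcos.le.trans hc
        positivity
      · rw [re_sin_sub_cos_mul]
        simp [hzm, -Complex.ofReal_sin, -Complex.ofReal_cos]
        nlinarith [mul_le_mul hc hs1 hs (hcos.le.trans hc)]
    · rw [← mulVec_mulVec, ← mulVec_mulVec, ← hUx, mulVec_mulVec _ Uᴴ, hU, one_mulVec, ← hUy]

theorem star_dotProduct_Hpart_mulVec {n : ℕ} (A : Matrix (Fin n) (Fin n) ℂ) (c : ℂ)
    (y : Fin n → ℂ) :
    star y ⬝ᵥ Hpart (c • A) *ᵥ y = ((c * (star y ⬝ᵥ A *ᵥ y)).re : ℂ) := by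
  have h : star y ⬝ᵥ Aᴴ *ᵥ y = conj (star y ⬝ᵥ A *ᵥ y) := by
    rw [dotProduct_mulVec, ← star_mulVec]
    exact star_dotProduct _ _
  rw [Hpart, conjTranspose_smul, smul_mulVec, add_mulVec, smul_mulVec, smul_mulVec,
    dotProduct_smul, dotProduct_add, dotProduct_smul, dotProduct_smul, h, Complex.re_eq_add_conj,
    map_mul]
  simp only [smul_eq_mul, RCLike.star_def]
  ring

/-- The symmetric case of the necessary condition, for the sector of half-angle `θ`. -/
theorem sectored_disk_necessary_symmetric {n : ℕ} (hn : 3 ≤ n) {γ θ : ℝ} (hγ : 0 < γ)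
    (hθ₀ : 0 < θ) (hθ₁ : θ < Real.pi / 2) (A : Matrix (Fin n) (Fin n) ℂ) (hA : IsUnit A.det)
    (h : ∀ B : Matrix (Fin n) (Fin n) ℂ,
      (((γ ^ 2 : ℝ) : ℂ) • (1 : Matrix (Fin n) (Fin n) ℂ) - Bᴴ * B).PosSemidef ∧
      (Hpart ((Real.sin θ + Real.cos θ * Complex.I : ℂ) • B)).PosSemidef ∧
      (Hpart ((Real.sin θ - Real.cos θ * Complex.I : ℂ) • B)).PosSemidef →
      (1 + A * B).det ≠ 0) :
    ∃ k₁ k₂ k₃ k₄ : ℝ, 0 ≤ k₁ ∧ 0 ≤ k₂ ∧ 0 ≤ k₃ ∧ 0 ≤ k₄ ∧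
      (k₁ • ((1 : Matrix (Fin n) (Fin n) ℂ) - ((γ ^ 2 : ℝ) : ℂ) • (Aᴴ * A))
        + k₂ • Hpart ((Real.sin θ - Real.cos θ * Complex.I : ℂ) • A)
        + k₃ • Hpart ((Real.sin θ + Real.cos θ * Complex.I : ℂ) • A)
        + k₄ • ((((γ / Real.cos θ : ℝ) : ℂ) • Hpart A) + 1)).PosDef := by
  have hcos : 0 < Real.cos θ := Real.cos_pos_of_mem_Ioo ⟨by linarith, hθ₁⟩
  have hsin : 0 < Real.sin θ := Real.sin_pos_of_pos_of_lt_pi hθ₀ (by linarith [Real.pi_pos])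
  set u : ℂ := Real.sin θ + Real.cos θ * Complex.I with hu
  set w : ℂ := Real.sin θ - Real.cos θ * Complex.I with hw
  have hAinj : ∀ y : Fin n → ℂ, y ≠ 0 → A *ᵥ y ≠ 0 := fun y hy h0 =>
    hy (Matrix.eq_zero_of_mulVec_eq_zero hA.ne_zero h0)
  have hHermA : (1 - ((γ ^ 2 : ℝ) : ℂ) • (Aᴴ * A)).IsHermitian := by
    apply isHermitian_one.sub
    rw [IsHermitian, conjTranspose_smul, conjTranspose_mul, conjTranspose_conjTranspose]
    simp
  set Φ : (Fin n → ℂ) → Fin 4 → ℝ := fun y =>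
    ![(star y ⬝ᵥ y).re - γ ^ 2 * (star (A *ᵥ y) ⬝ᵥ (A *ᵥ y)).re, (w * (star y ⬝ᵥ A *ᵥ y)).re,
      (u * (star y ⬝ᵥ A *ᵥ y)).re,
      γ / Real.cos θ * (star y ⬝ᵥ A *ᵥ y).re + (star y ⬝ᵥ y).re] with hΦ
  have hQ₀ : ∀ y : Fin n → ℂ, star y ⬝ᵥ (1 - ((γ ^ 2 : ℝ) : ℂ) • (Aᴴ * A)) *ᵥ y = Φ y 0 := by
    intro y
    have h1 := star_mulVec_dotProduct_mulVec 1 A y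
    rw [one_mulVec, Matrix.mul_one] at h1
    rw [sub_mulVec, one_mulVec, smul_mulVec, dotProduct_sub, dotProduct_smul, ← h1,
      star_dotProduct_self_eq_ofReal y, star_dotProduct_self_eq_ofReal (A *ᵥ y)]
    simp [hΦ]
  have hQ₁ : ∀ y : Fin n → ℂ, star y ⬝ᵥ Hpart (w • A) *ᵥ y = Φ y 1 :=
    star_dotProduct_Hpart_mulVec A w
  have hQ₂ : ∀ y : Fin n → ℂ, star y ⬝ᵥ Hpart (u • A) *ᵥ y = Φ y 2 :=
    star_dotProduct_Hpart_mulVec A u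
  have hQ₃ : ∀ y : Fin n → ℂ,
      star y ⬝ᵥ (((γ / Real.cos θ : ℝ) : ℂ) • Hpart A + 1) *ᵥ y = Φ y 3 := by
    intro y
    have h1 := star_dotProduct_Hpart_mulVec A 1 y
    rw [one_smul, one_mul] at h1
    rw [add_mulVec, one_mulVec, smul_mulVec, dotProduct_add, dotProduct_smul, h1,
      star_dotProduct_self_eq_ofReal y]
    simp [hΦ]
  have hΦ₃ : ∀ y, Φ y 3 = γ / (2 * Real.sin θ * Real.cos θ) * (Φ y 1 + Φ y 2) +
      (star y ⬝ᵥ y).re := by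
    intro y
    have h1 : Φ y 1 + Φ y 2 = 2 * Real.sin θ * (star y ⬝ᵥ A *ᵥ y).re := by
      change (w * (star y ⬝ᵥ A *ᵥ y)).re + (u * (star y ⬝ᵥ A *ᵥ y)).re = _
      rw [hu, hw, re_sin_add_cos_mul, re_sin_sub_cos_mul]
      ring
    rw [h1]
    change γ / Real.cos θ * (star y ⬝ᵥ A *ᵥ y).re + (star y ⬝ᵥ y).re = _
    field_simp
  have hcont : Continuous Φ := by
    have h1 : Continuous fun y : Fin n → ℂ => A *ᵥ y := by fun_prop
    have h2 : Continuous fun y : Fin n → ℂ => star y ⬝ᵥ y := by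
      unfold dotProduct; fun_prop
    have h3 : Continuous fun y : Fin n → ℂ => star y ⬝ᵥ A *ᵥ y := by
      unfold dotProduct; fun_prop
    have h4 := h2.comp h1
    simp only [Function.comp_def] at h4
    refine continuous_pi fun i => ?_
    fin_cases i <;> simp [hΦ, -Complex.mul_re] <;> fun_prop
  have hconv : Convex ℝ (Φ '' {y | star y ⬝ᵥ y = 1}) := by
    have hS := convex_jointNumericalRange hn
      ![1 - ((γ ^ 2 : ℝ) : ℂ) • (Aᴴ * A), Hpart (w • A), Hpart (u • A)]
      (by
        intro j
        fin_cases j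
        · exact hHermA
        · exact Hpart_isHermitian _
        · exact Hpart_isHermitian _)
    have hmem : ∀ y : Fin n → ℂ, ∀ j, star y ⬝ᵥ
        (![1 - ((γ ^ 2 : ℝ) : ℂ) • (Aᴴ * A), Hpart (w • A), Hpart (u • A)] j) *ᵥ y =
          (Φ y j.castSucc : ℂ) := by
      intro y j
      fin_cases j
      · exact hQ₀ y
      · exact hQ₁ y
      · exact hQ₂ y
    rintro _ ⟨y₁, hy₁, rfl⟩ _ ⟨y₂, hy₂, rfl⟩ a b ha hb hab
    obtain ⟨y, hy, hyp⟩ := hS ⟨y₁, hy₁, hmem y₁⟩ ⟨y₂, hy₂, hmem y₂⟩ ha hb hab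
    have hj : ∀ j : Fin 3, Φ y j.castSucc = a * Φ y₁ j.castSucc + b * Φ y₂ j.castSucc := by
      intro j
      have := hyp j
      rw [hmem] at this
      exact_mod_cast this
    refine ⟨y, hy, ?_⟩
    have h1 : Φ y 1 = a * Φ y₁ 1 + b * Φ y₂ 1 := hj 1
    have h2 : Φ y 2 = a * Φ y₁ 2 + b * Φ y₂ 2 := hj 2
    ext i
    refine Fin.lastCases ?_ hj i
    change Φ y 3 = a * Φ y₁ 3 + b * Φ y₂ 3
    rw [hΦ₃, hΦ₃ y₁, hΦ₃ y₂, h1, h2, show star y ⬝ᵥ y = 1 from hy,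
      show star y₁ ⬝ᵥ y₁ = 1 from hy₁, show star y₂ ⬝ᵥ y₂ = 1 from hy₂]
    simp only [Complex.one_re]
    linear_combination -hab
  obtain ⟨k, hk, hpos⟩ := exists_nonneg_combination_pos hconv
    ((isCompact_unitVectors n).image hcont) (by
      rintro _ ⟨y, hy, rfl⟩
      by_contra! hle
      have hy0 : y ≠ 0 := by
        rintro rfl
        simp at hy
      have hx0 : -(A *ᵥ y) ≠ 0 := neg_ne_zero.2 (hAinj y hy0)
      have hxx : star (-(A *ᵥ y)) ⬝ᵥ (-(A *ᵥ y)) = star (A *ᵥ y) ⬝ᵥ (A *ᵥ y) := by simp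
      have hxy : star (-(A *ᵥ y)) ⬝ᵥ y = -conj (star y ⬝ᵥ A *ᵥ y) := by
        rw [star_neg, neg_dotProduct]
        exact congrArg Neg.neg (star_dotProduct _ _)
      have e0 : (star y ⬝ᵥ y).re - γ ^ 2 * (star (A *ᵥ y) ⬝ᵥ (A *ᵥ y)).re ≤ 0 := hle 0
      have e1 : (w * (star y ⬝ᵥ A *ᵥ y)).re ≤ 0 := hle 1
      have e2 : (u * (star y ⬝ᵥ A *ᵥ y)).re ≤ 0 := hle 2
      have e3 : γ / Real.cos θ * (star y ⬝ᵥ A *ᵥ y).re + (star y ⬝ᵥ y).re ≤ 0 := hle 3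
      rw [hw, re_sin_sub_cos_mul] at e1
      rw [hu, re_sin_add_cos_mul] at e2
      obtain ⟨B, hB, hBx⟩ := exists_sectored_mulVec_eq hn hγ hθ₀ hθ₁ hx0 hy0
        (by rw [hxx]; linarith)
        (by
          rw [hxy, re_sin_add_cos_mul]
          simp only [Complex.neg_re, Complex.neg_im, Complex.conj_re, Complex.conj_im]
          linarith)
        (by
          rw [hxy, re_sin_sub_cos_mul]
          simp only [Complex.neg_re, Complex.neg_im, Complex.conj_re, Complex.conj_im]
          linarith)
        (by
          rw [hxy]
          simp only [Complex.neg_re, Complex.conj_re]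
          have h5 : (γ / Real.cos θ * (star y ⬝ᵥ A *ᵥ y).re + (star y ⬝ᵥ y).re) * Real.cos θ ≤ 0 :=
            mul_nonpos_of_nonpos_of_nonneg e3 hcos.le
          have h6 : (γ / Real.cos θ * (star y ⬝ᵥ A *ᵥ y).re + (star y ⬝ᵥ y).re) * Real.cos θ =
              γ * (star y ⬝ᵥ A *ᵥ y).re + (star y ⬝ᵥ y).re * Real.cos θ := by
            field_simp
          linarith)
      apply h B hB
      apply Matrix.exists_mulVec_eq_zero_iff.1
      refine ⟨_, hx0, ?_⟩
      rw [add_mulVec, one_mulVec, ← mulVec_mulVec, hBx]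
      simp)
  refine ⟨k 0, k 1, k 2, k 3, hk 0, hk 1, hk 2, hk 3, ?_⟩
  set M : Matrix (Fin n) (Fin n) ℂ := k 0 • (1 - ((γ ^ 2 : ℝ) : ℂ) • (Aᴴ * A))
    + k 1 • Hpart (w • A) + k 2 • Hpart (u • A)
    + k 3 • (((γ / Real.cos θ : ℝ) : ℂ) • Hpart A + 1) with hM
  have hform : ∀ y : Fin n → ℂ, star y ⬝ᵥ M *ᵥ y = ((∑ i, k i * Φ y i : ℝ) : ℂ) := by
    intro y
    have hcomb : ∀ (c : Fin 4 → ℝ) (P₀ P₁ P₂ P₃ : Matrix (Fin n) (Fin n) ℂ),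
        star y ⬝ᵥ (c 0 • P₀ + c 1 • P₁ + c 2 • P₂ + c 3 • P₃) *ᵥ y =
          c 0 * (star y ⬝ᵥ P₀ *ᵥ y) + c 1 * (star y ⬝ᵥ P₁ *ᵥ y) +
            c 2 * (star y ⬝ᵥ P₂ *ᵥ y) + c 3 * (star y ⬝ᵥ P₃ *ᵥ y) := by
      intro c P₀ P₁ P₂ P₃
      simp only [add_mulVec, smul_mulVec, dotProduct_add, dotProduct_smul, Complex.real_smul]
    rw [hM, hcomb, hQ₀, hQ₁, hQ₂, hQ₃, Fin.sum_univ_four]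
    push_cast
    ring
  have hreal : ∀ (t : ℝ) {N : Matrix (Fin n) (Fin n) ℂ}, N.IsHermitian → (t • N).IsHermitian := by
    intro t N hN
    rw [IsHermitian, conjTranspose_smul, hN.eq]
    simp
  refine PosDef.of_dotProduct_mulVec_pos ?_ fun y hy => ?_
  · refine (((hreal _ hHermA).add (hreal _ (Hpart_isHermitian _))).add
      (hreal _ (Hpart_isHermitian _))).add (hreal _ (IsHermitian.add ?_ isHermitian_one))
    rw [Complex.coe_smul]
    exact hreal _ (Hpart_isHermitian _)
  · have hN := re_star_dotProduct_self_pos hy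
    have hyy := star_dotProduct_self_eq_ofReal y
    set N := (star y ⬝ᵥ y).re
    have hsq : (√(N⁻¹) : ℂ) * conj (√(N⁻¹) : ℂ) = ((N⁻¹ : ℝ) : ℂ) := by
      rw [Complex.conj_ofReal]
      exact_mod_cast Real.mul_self_sqrt (by positivity)
    have hunit : star ((√(N⁻¹) : ℂ) • y) ⬝ᵥ ((√(N⁻¹) : ℂ) • y) = 1 := by
      have := star_smul_dotProduct_mulVec_smul 1 (√(N⁻¹) : ℂ) y
      rw [one_mulVec, one_mulVec, hyy, hsq, ← Complex.ofReal_mul, inv_mul_cancel₀ hN.ne'] at this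
      simpa using this
    have h1 := hpos _ ⟨_, hunit, rfl⟩
    have h2 := hform ((√(N⁻¹) : ℂ) • y)
    rw [star_smul_dotProduct_mulVec_smul, hsq, hform, ← Complex.ofReal_mul,
      Complex.ofReal_inj] at h2
    rw [← h2] at h1
    rw [hform]
    exact Complex.zero_lt_real.2 (pos_of_mul_pos_right h1 (by positivity))

/-- Necessary condition for the asymmetric matrix sectored-disk problem. -/
theorem sectored_disk_necessary_asymmetric {n : ℕ} (hn : 3 ≤ n) (γ α β : ℝ) (hγ : 0 < γ)
    (hαβ₁ : -Real.pi ≤ (α + β) / 2) (hαβ₂ : (α + β) / 2 < Real.pi)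
    (hαβ₃ : 0 < β - α) (hαβ₄ : β - α < Real.pi)
    (A : Matrix (Fin n) (Fin n) ℂ) (hA : IsUnit A.det)
    (h : ∀ B : Matrix (Fin n) (Fin n) ℂ, memSDab γ α β B → (1 + A * B).det ≠ 0) :
    ∃ k₁ k₂ k₃ k₄ : ℝ, 0 ≤ k₁ ∧ 0 ≤ k₂ ∧ 0 ≤ k₃ ∧ 0 ≤ k₄ ∧
      (k₁ • ((1 : Matrix (Fin n) (Fin n) ℂ) - ((γ ^ 2 : ℝ) : ℂ) • (Aᴴ * A))
        + k₂ • Hpart (Complex.exp (-Complex.I * ((Real.pi / 2 - β : ℝ) : ℂ)) • A)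
        + k₃ • Hpart (Complex.exp (Complex.I * ((Real.pi / 2 + α : ℝ) : ℂ)) • A)
        + k₄ • ((((γ / Real.cos ((β - α) / 2) : ℝ) : ℂ) •
            Hpart (Complex.exp (Complex.I * (((α + β) / 2 : ℝ) : ℂ)) • A)) + 1)).PosDef := by
  set θ : ℝ := (β - α) / 2 with hθ
  set φ : ℝ := (α + β) / 2 with hφ
  set e : ℂ := Complex.exp (Complex.I * (φ : ℂ)) with he
  have hu : Complex.exp (Complex.I * ((Real.pi / 2 - θ : ℝ) : ℂ)) =
      Real.sin θ + Real.cos θ * Complex.I := by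
    rw [mul_comm, Complex.exp_mul_I, ← Complex.ofReal_cos, ← Complex.ofReal_sin,
      Real.cos_pi_div_two_sub, Real.sin_pi_div_two_sub]
  have hw : Complex.exp (-Complex.I * ((Real.pi / 2 - θ : ℝ) : ℂ)) =
      Real.sin θ - Real.cos θ * Complex.I := by
    rw [neg_mul, mul_comm, ← neg_mul, Complex.exp_mul_I, Complex.cos_neg, Complex.sin_neg,
      ← Complex.ofReal_cos, ← Complex.ofReal_sin, Real.cos_pi_div_two_sub,
      Real.sin_pi_div_two_sub]
    ring
  have hee : star e * e = 1 := by
    rw [he, RCLike.star_def, mul_comm, Complex.mul_conj, Complex.normSq_eq_norm_sq, mul_comm,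
      Complex.norm_exp_ofReal_mul_I]
    simp
  have hβB : Complex.exp (Complex.I * ((Real.pi / 2 - β : ℝ) : ℂ)) * e =
      Real.sin θ + Real.cos θ * Complex.I := by
    rw [← hu, he, ← Complex.exp_add, hφ, hθ]
    congr 1
    push_cast
    ring
  have hαB : Complex.exp (-Complex.I * ((Real.pi / 2 + α : ℝ) : ℂ)) * e =
      Real.sin θ - Real.cos θ * Complex.I := by
    rw [← hw, he, ← Complex.exp_add, hφ, hθ]
    congr 1
    push_cast
    ring
  have hβA : Complex.exp (-Complex.I * ((Real.pi / 2 - β : ℝ) : ℂ)) =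
      (Real.sin θ - Real.cos θ * Complex.I) * e := by
    rw [← hw, he, ← Complex.exp_add, hφ, hθ]
    congr 1
    push_cast
    ring
  have hαA : Complex.exp (Complex.I * ((Real.pi / 2 + α : ℝ) : ℂ)) =
      (Real.sin θ + Real.cos θ * Complex.I) * e := by
    rw [← hu, he, ← Complex.exp_add, hφ, hθ]
    congr 1
    push_cast
    ring
  have key := sectored_disk_necessary_symmetric hn hγ (θ := θ) (by linarith) (by linarith) (e • A)
    (by
      rw [det_smul]
      exact (IsUnit.pow _ (Complex.exp_ne_zero _).isUnit).mul hA)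
    (by
      rintro B ⟨h1, h2, h3⟩
      have hdet := h (e • B) ⟨by
        rw [conjTranspose_smul, Matrix.smul_mul, Matrix.mul_smul, smul_smul, hee, one_smul]
        exact h1, by rwa [smul_smul, hβB], by rwa [smul_smul, hαB]⟩
      rwa [Matrix.smul_mul, ← Matrix.mul_smul])
  rw [conjTranspose_smul, Matrix.smul_mul, Matrix.mul_smul, smul_smul (star e), hee, one_smul,
    smul_smul _ e, smul_smul _ e] at key
  rw [hβA, hαA]
  exact key
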